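/- For every $\xi \in \mathbb{R}^3$ with $\|\xi\| < 2\pi$, the right Jacobian matrix $J_r(\xi)$ is invertible (i.e. its inverse $J_r^{-1}(\xi)$ is well-defined under the condition $\|\xi\| < 2\pi$). -/

import Mathlib

open Matrix

noncomputable section

/-- The hat (cross-product) operator: `hat a * b = a ×₃ b`. -/
def hat (a : Fin 3 → ℝ) : Matrix (Fin 3) (Fin 3) ℝ :=
  !![0, -a 2, a 1; a 2, 0, -a 0; -a 1, a 0, 0]

/-- The Euclidean norm on `ℝ³`. -/
def enorm3 (a : Fin 3 → ℝ) : ℝ := Real.sqrt (∑ i, a i ^ 2)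

/-- The right Jacobian of SO(3). -/
def Jr (ξ : Fin 3 → ℝ) : Matrix (Fin 3) (Fin 3) ℝ :=
  if ξ = 0 then 1 else
    1 - ((1 - Real.cos (enorm3 ξ)) / (enorm3 ξ) ^ 2) • hat ξ
      + ((enorm3 ξ - Real.sin (enorm3 ξ)) / (enorm3 ξ) ^ 3) • (hat ξ) ^ 2

/-- The determinant of a quadratic polynomial in `hat x` with constant term `1`. -/
theorem det_one_sub_smul_hat_add_smul_hat_sq (x : Fin 3 → ℝ) (a b : ℝ) :
    (1 - a • hat x + b • hat x ^ 2).det =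
      (1 - b * ∑ i, x i ^ 2) ^ 2 + a ^ 2 * ∑ i, x i ^ 2 := by
  simp [hat, pow_two, Matrix.det_fin_three, Fin.sum_univ_three]
  ring

theorem enorm3_sq (x : Fin 3 → ℝ) : enorm3 x ^ 2 = ∑ i, x i ^ 2 :=
  Real.sq_sqrt (Finset.sum_nonneg fun _ _ => sq_nonneg _)

theorem enorm3_pos {x : Fin 3 → ℝ} (hx : x ≠ 0) : 0 < enorm3 x := by
  obtain ⟨i, hi⟩ := Function.ne_iff.mp hx
  exact Real.sqrt_pos.mpr <| Finset.sum_pos' (fun _ _ => sq_nonneg _)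
    ⟨i, Finset.mem_univ i, sq_pos_of_ne_zero hi⟩

/-- Away from the origin, `det (Jr ξ) = 2 (1 - cos ‖ξ‖) / ‖ξ‖ ^ 2`. -/
theorem det_Jr {ξ : Fin 3 → ℝ} (hξ : ξ ≠ 0) :
    (Jr ξ).det = 2 * (1 - Real.cos (enorm3 ξ)) / enorm3 ξ ^ 2 := by
  have hpos := (enorm3_pos hξ).ne'
  rw [Jr, if_neg hξ, det_one_sub_smul_hat_add_smul_hat_sq, ← enorm3_sq]
  field_simp
  linear_combination Real.sin_sq_add_cos_sq (enorm3 ξ)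

/-- The right Jacobian `Jr ξ` is invertible whenever `‖ξ‖ < 2π`. -/
theorem jr_invertible (ξ : Fin 3 → ℝ) (h : enorm3 ξ < 2 * Real.pi) :
    IsUnit (Jr ξ) := by
  by_cases hξ : ξ = 0
  · simp [Jr, hξ]
  have hpos := enorm3_pos hξ
  have hcos : Real.cos (enorm3 ξ) ≠ 1 := fun hc =>
    hpos.ne' ((Real.cos_eq_one_iff_of_lt_of_lt (by linarith [Real.pi_pos]) h).mp hc)
  rw [Matrix.isUnit_iff_isUnit_det, isUnit_iff_ne_zero, det_Jr hξ]
  have := sub_ne_zero.mpr hcos.symm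
  positivity
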